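/- For any vertices i, j, r, s with i ≠ r, j ≠ i, and s ≠ r, E[w_{ij} w_{rs}] = ((1 - f_1(p,n))/(n-1))^2. (This covers all the cases E[w_{ij}w_{ji}], E[w_{ij}w_{js}], E[w_{ij}w_{ri}], E[w_{ij}w_{rj}], and E[w_{ij}w_{rs}] with all four indices distinct.) -/

import Mathlib

open MeasureTheory ProbabilityTheory Finset

/-- The expectation of `h` under the binomial distribution with parameters `m` and `p`,
defined by conditioning on one trial at a time. -/
noncomputable def binomialExpectation (p : ℝ) : ℕ → (ℝ → ℝ) → ℝ
  | 0, h => h 0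
  | m + 1, h =>
    (1 - p) * binomialExpectation p m h + p * binomialExpectation p m (fun x => h (x + 1))

namespace binomialExpectation

variable {p : ℝ}

theorem eq_of_forall_nonneg (m : ℕ) {h : ℝ → ℝ} {c : ℝ} (hc : ∀ x, 0 ≤ x → h x = c) :
    binomialExpectation p m h = c := by
  induction m generalizing h with
  | zero => exact hc 0 le_rfl
  | succ m ih =>
    rw [binomialExpectation, ih hc, ih fun x hx => hc (x + 1) (by linarith)]
    ring

theorem add (m : ℕ) (g h : ℝ → ℝ) :
    binomialExpectation p m (fun x => g x + h x)
      = binomialExpectation p m g + binomialExpectation p m h := by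
  induction m generalizing g h with
  | zero => rfl
  | succ m ih =>
    simp only [binomialExpectation, ih]
    ring

/-- The size-biasing identity `E[S h(S)] = (m + 1) p E[h(T + 1)]` for binomial variables `S`, `T`
with `m + 1` and `m` trials. -/
theorem id_mul (m : ℕ) (h : ℝ → ℝ) :
    binomialExpectation p (m + 1) (fun x => x * h x)
      = (m + 1) * p * binomialExpectation p m (fun x => h (x + 1)) := by
  induction m generalizing h with
  | zero => simp [binomialExpectation]
  | succ m ih =>
    have key : binomialExpectation p (m + 1) (fun x => (x + 1) * h (x + 1))
        = (m + 1) * p * binomialExpectation p m (fun x => h (x + 1 + 1))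
          + binomialExpectation p (m + 1) (fun x => h (x + 1)) := by
      rw [← ih fun x => h (x + 1), ← add]
      congr 1
      ext x
      ring
    rw [binomialExpectation, ih, key, binomialExpectation]
    push_cast
    ring

theorem id_mul_inv (m : ℕ) :
    binomialExpectation p m (fun x => x * x⁻¹) = 1 - (1 - p) ^ m := by
  induction m with
  | zero => simp [binomialExpectation]
  | succ m ih =>
    rw [binomialExpectation, ih, eq_of_forall_nonneg (c := 1) m
      fun x hx => mul_inv_cancel₀ (by linarith)]
    ring

theorem inv_add_one (hp : p ≠ 0) (m : ℕ) :
    binomialExpectation p m (fun x => (x + 1)⁻¹) = (1 - (1 - p) ^ (m + 1)) / ((m + 1) * p) := by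
  have hm : (m + 1 : ℝ) ≠ 0 := by positivity
  rw [← id_mul_inv, id_mul m fun x => x⁻¹]
  field_simp

theorem mul_inv_add_two (hp : p ≠ 0) (m : ℕ) :
    p * binomialExpectation p m (fun x => (x + 1 + 1)⁻¹)
      = (1 - (1 - (1 - p) ^ (m + 2)) / ((m + 2) * p)) / (m + 1) := by
  have h := inv_add_one hp (m + 1)
  rw [binomialExpectation, inv_add_one hp m] at h
  have hm : (m + 1 : ℝ) ≠ 0 := by positivity
  have hm2 : (m + 2 : ℝ) ≠ 0 := by positivity
  have e : ((m + 1 : ℕ) : ℝ) + 1 = m + 2 := by push_cast; ring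
  rw [e] at h
  rw [eq_sub_of_add_eq' h]
  field_simp
  ring

end binomialExpectation

section Bernoulli

variable {Ω ι : Type*} [MeasurableSpace Ω] {μ : Measure Ω} {p : ℝ}

theorem integral_eq_of_zero_or_one {X : Ω → ℝ} (hp : 0 ≤ p) (hX : ∀ ω, X ω = 0 ∨ X ω = 1)
    (hm : Measurable X) (hX1 : μ {ω | X ω = 1} = ENNReal.ofReal p) : ∫ ω, X ω ∂μ = p := by
  have hind : X = Set.indicator {ω | X ω = 1} 1 := by
    ext ω
    rcases hX ω with h | h <;> simp [Set.indicator, h]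
  rw [hind, integral_indicator_one (measurableSet_eq_fun hm measurable_const), measureReal_def, hX1,
    ENNReal.toReal_ofReal hp]

variable {X : ι → Ω → ℝ}

theorem integral_mul_comp_sum (hm : ∀ e, Measurable (X e)) (hind : iIndepFun X μ)
    {S : Finset ι} {e : ι} (he : e ∉ S) {g h : ℝ → ℝ} (hg : Measurable g) (hh : Measurable h) :
    ∫ ω, g (X e ω) * h (∑ k ∈ S, X k ω) ∂μ
      = (∫ ω, g (X e ω) ∂μ) * ∫ ω, h (∑ k ∈ S, X k ω) ∂μ := by
  classical
  have hi := (hind.indepFun_finsetSum_of_notMem hm he).symm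
  have hi' := hi.comp hg hh
  have hs : Measurable (∑ k ∈ S, X k) := by
    rw [Finset.sum_fn]
    exact Finset.measurable_sum S fun k _ => hm k
  simpa [Function.comp_def] using hi'.integral_fun_mul_eq_mul_integral
    (hg.comp (hm e)).aestronglyMeasurable (hh.comp hs).aestronglyMeasurable

variable [IsProbabilityMeasure μ]

theorem integrable_comp_sum (hX : ∀ e ω, X e ω = 0 ∨ X e ω = 1) (hm : ∀ e, Measurable (X e))
    (S : Finset ι) {h : ℝ → ℝ} (hh : Measurable h) {C : ℝ} (hC : ∀ x, 0 ≤ x → |h x| ≤ C) :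
    Integrable (fun ω => h (∑ e ∈ S, X e ω)) μ := by
  refine Integrable.of_bound
    (hh.comp (Finset.measurable_sum S fun e _ => hm e)).aestronglyMeasurable C
    (ae_of_all _ fun ω => hC _ (Finset.sum_nonneg fun e _ => ?_))
  rcases hX e ω with h | h <;> simp [h]

theorem integral_comp_sum (hX : ∀ e ω, X e ω = 0 ∨ X e ω = 1) (hm : ∀ e, Measurable (X e))
    (hind : iIndepFun X μ) (hmean : ∀ e, ∫ ω, X e ω ∂μ = p) (S : Finset ι) {h : ℝ → ℝ}
    (hh : Measurable h) {C : ℝ} (hC : ∀ x, 0 ≤ x → |h x| ≤ C) :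
    ∫ ω, h (∑ e ∈ S, X e ω) ∂μ = binomialExpectation p S.card h := by
  classical
  induction S using Finset.induction_on generalizing h with
  | empty => simp [binomialExpectation]
  | insert e S he ih =>
    have hh' : Measurable fun x => h (x + 1) := hh.comp (measurable_id.add_const 1)
    have hC' : ∀ x, 0 ≤ x → |h (x + 1)| ≤ C := fun x hx => hC _ (by linarith)
    have split : ∀ ω, h (∑ k ∈ insert e S, X k ω)
        = (1 - X e ω) * h (∑ k ∈ S, X k ω) + X e ω * h ((∑ k ∈ S, X k ω) + 1) := by
      intro ω
      rw [Finset.sum_insert he]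
      rcases hX e ω with h0 | h0 <;> simp [h0, add_comm]
    have hb : ∀ ω, ‖1 - X e ω‖ ≤ 1 ∧ ‖X e ω‖ ≤ 1 := by
      intro ω
      rcases hX e ω with h0 | h0 <;> simp [h0]
    have i1 : Integrable (fun ω => (1 - X e ω) * h (∑ k ∈ S, X k ω)) μ :=
      (integrable_comp_sum hX hm S hh hC).bdd_mul
        ((hm e).const_sub 1).aestronglyMeasurable (ae_of_all _ fun ω => (hb ω).1)
    have i2 : Integrable (fun ω => X e ω * h ((∑ k ∈ S, X k ω) + 1)) μ :=
      (integrable_comp_sum hX hm S hh' hC').bdd_mul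
        (hm e).aestronglyMeasurable (ae_of_all _ fun ω => (hb ω).2)
    have iX : Integrable (X e) μ :=
      Integrable.of_bound (hm e).aestronglyMeasurable 1 (ae_of_all _ fun ω => (hb ω).2)
    simp_rw [split]
    rw [integral_add i1 i2,
      integral_mul_comp_sum hm hind he (g := fun x => 1 - x) (measurable_id.const_sub 1) hh,
      integral_mul_comp_sum hm hind he (g := fun x => x) measurable_id hh', ih hh hC, ih hh' hC',
      integral_sub (integrable_const _) iX, hmean, Finset.card_insert_of_notMem he,
      binomialExpectation]
    simp

theorem integral_div_sum_add_one (hX : ∀ e ω, X e ω = 0 ∨ X e ω = 1)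
    (hm : ∀ e, Measurable (X e)) (hind : iIndepFun X μ) (hmean : ∀ e, ∫ ω, X e ω ∂μ = p)
    (hp : p ≠ 0) {S : Finset ι} {e : ι} (he : e ∈ S) {n : ℕ} (hn : S.card + 1 = n) :
    ∫ ω, X e ω / ((∑ k ∈ S, X k ω) + 1) ∂μ
      = (1 - (1 - (1 - p) ^ n) / (n * p)) / (n - 1) := by
  classical
  have hh : Measurable fun x : ℝ => (x + 1 + 1)⁻¹ := by fun_prop
  have hC : ∀ x : ℝ, 0 ≤ x → |(x + 1 + 1)⁻¹| ≤ 1 := by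
    intro x hx
    rw [abs_of_nonneg (by positivity)]
    exact inv_le_one_of_one_le₀ (by linarith)
  have split : ∀ ω, X e ω / ((∑ k ∈ S, X k ω) + 1)
      = X e ω * ((∑ k ∈ S.erase e, X k ω) + 1 + 1)⁻¹ := by
    intro ω
    rw [← Finset.add_sum_erase S _ he]
    rcases hX e ω with h0 | h0
    · simp [h0]
    · rw [h0, div_eq_mul_inv, add_comm (1 : ℝ) (∑ k ∈ S.erase e, X k ω)]
  simp_rw [split]
  rw [integral_mul_comp_sum hm hind (Finset.notMem_erase e S) (g := fun x => x) measurable_id hh,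
    integral_comp_sum hX hm hind hmean _ hh hC, hmean, binomialExpectation.mul_inv_add_two hp]
  have hcard := Finset.card_erase_add_one he
  have hn' : n = (S.erase e).card + 2 := by omega
  rw [hn']
  push_cast
  congr 1
  ring

end Bernoulli

/-- For vertices `i, j, r, s` with `i ≠ r`, `j ≠ i` and `s ≠ r`,
`E[w_{ij} w_{rs}] = ((1-f₁(p,n))/(n-1))²` (this covers all the cases `E[w_{ij}w_{ji}]`,
`E[w_{ij}w_{js}]`, `E[w_{ij}w_{ri}]`, `E[w_{ij}w_{rj}]`, and `E[w_{ij}w_{rs}]` with all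
four indices distinct). -/
theorem expected_wij_wrs
    {Ω : Type*} [MeasurableSpace Ω] (μ : Measure Ω) [IsProbabilityMeasure μ]
    (n : ℕ) (hn : 2 ≤ n) (p q : ℝ) (hp : p ∈ Set.Ioc (0 : ℝ) 1) (hq : q = 1 - p)
    (a : Fin n → Fin n → Ω → ℝ)
    (ha01 : ∀ i j ω, a i j ω = 0 ∨ a i j ω = 1)
    (hdiag : ∀ i ω, a i i ω = 0)
    (hmeas : ∀ i j, Measurable (a i j))
    (hber : ∀ i j, i ≠ j → μ {ω | a i j ω = 1} = ENNReal.ofReal p)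
    (hind : iIndepFun (m := fun _ => Real.measurableSpace)
      (fun ij : {ij : Fin n × Fin n // ij.1 ≠ ij.2} => a ij.1.1 ij.1.2) μ)
    (d : Fin n → Ω → ℝ) (hd : ∀ i ω, d i ω = ∑ j, a i j ω)
    (f₁ : ℝ) (hf₁ : f₁ = (1 - q ^ n) / (n * p))
    (i j r s : Fin n) (hir : i ≠ r) (hji : j ≠ i) (hsr : s ≠ r) :
    (∫ ω, (a i j ω / (d i ω + 1)) * (a r s ω / (d r ω + 1)) ∂μ)
      = ((1 - f₁) / (n - 1)) ^ 2 := by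
  classical
  have hp0 : p ≠ 0 := hp.1.ne'
  set X : {ij : Fin n × Fin n // ij.1 ≠ ij.2} → Ω → ℝ := fun e => a e.1.1 e.1.2 with hXdef
  have hX : ∀ e ω, X e ω = 0 ∨ X e ω = 1 := fun e ω => ha01 _ _ ω
  have hm : ∀ e, Measurable (X e) := fun e => hmeas _ _
  have hmean : ∀ e, ∫ ω, X e ω ∂μ = p := fun e =>
    integral_eq_of_zero_or_one hp.1.le (hX e) (hm e) (hber _ _ e.2)
  let R : Fin n → Finset {ij : Fin n × Fin n // ij.1 ≠ ij.2} := fun i =>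
    (Finset.univ : Finset {k : Fin n // k ≠ i}).map
      ⟨fun k => ⟨(i, k.1), k.2.symm⟩, fun k l hkl => by
        simpa [Subtype.ext_iff] using hkl⟩
  have hRmem : ∀ i e, e ∈ R i ↔ e.1.1 = i := by
    rintro i ⟨⟨x, y⟩, hxy⟩
    simp only [R, Finset.mem_map, Finset.mem_univ, true_and]
    constructor
    · rintro ⟨k, h⟩
      exact congrArg (fun e => e.1.1) h.symm
    · rintro rfl
      exact ⟨⟨y, hxy.symm⟩, rfl⟩
  have hRcard : ∀ i, (R i).card + 1 = n := by
    intro i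
    simp only [R, Finset.card_map, Finset.card_univ, Fintype.card_subtype_compl,
      Fintype.card_subtype_eq, Fintype.card_fin]
    omega
  have hdR : ∀ i ω, d i ω = ∑ e ∈ R i, X e ω := by
    intro i ω
    simp only [R, Finset.sum_map, hXdef]
    rw [hd, ← Finset.add_sum_erase _ _ (Finset.mem_univ i), hdiag, zero_add]
    exact (Finset.sum_subtype _ (by simp) fun k => a i k ω)
  have hrow : ∀ i j, j ≠ i → ∫ ω, a i j ω / (d i ω + 1) ∂μ = (1 - f₁) / (n - 1) := by
    intro i j hji
    simp_rw [hdR]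
    rw [hf₁, hq]
    exact integral_div_sum_add_one hX hm hind hmean hp0
      (e := ⟨(i, j), hji.symm⟩) ((hRmem _ _).2 rfl) (hRcard i)
  have hdisj : Disjoint (R i) (R r) := by
    rw [Finset.disjoint_left]
    intro e hi hr
    exact hir (((hRmem _ _).1 hi).symm.trans ((hRmem _ _).1 hr))
  have hwmeas : ∀ i (e : R i),
      Measurable fun x : R i → ℝ => x e / ((∑ k, x k) + 1) := by
    intro i e
    fun_prop
  have hindep : IndepFun (fun ω => a i j ω / (d i ω + 1)) (fun ω => a r s ω / (d r ω + 1)) μ := by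
    have h := (hind.indepFun_finset (R i) (R r) hdisj hm).comp
      (hwmeas i ⟨⟨(i, j), hji.symm⟩, (hRmem _ _).2 rfl⟩)
      (hwmeas r ⟨⟨(r, s), hsr.symm⟩, (hRmem _ _).2 rfl⟩)
    have hs : ∀ i ω, ∑ k : R i, X k ω = d i ω := fun i ω => by
      rw [hdR, Finset.sum_coe_sort (R i) fun k => X k ω]
    simpa only [Function.comp_def, hs] using h
  have hw : ∀ i j, Measurable fun ω => a i j ω / (d i ω + 1) := by
    intro i j
    simp_rw [hd]
    fun_prop
  rw [hindep.integral_fun_mul_eq_mul_integral (hw i j).aestronglyMeasurable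
    (hw r s).aestronglyMeasurable, hrow i j hji, hrow r s hsr, sq]
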